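/- arXiv:2105.03130 — 3 statements merged into one kernel-verified Lean document; each statement's English description precedes it below -/
import Mathlib

section
/- Let $(X,\mathcal{B}_X,\mu,T)$ be a $\mathbb{Z}^2$-MPS and $\vec v=(1,\beta)\in\mathbb{R}^2$ a direction vector. Then $\mu$ has $\vec v$-discrete spectrum if and only if $(X,\mathcal{B}_X,\mu,T)$ is $\vec v$-null. -/
open MeasureTheory Filter Set
open scoped ENNReal Topology

namespace Directional

noncomputable section

attribute [local instance] Classical.propDecidable

variable {X : Type*} [MeasurableSpace X] {G : Type*}

/-- The set of Koopman images `U_T^w 1_B` for `w ∈ Λ`, as elements of `L²(μ)`. -/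
def korbit (μ : Measure X) (T : G → X → X) (Λ : Set G) (B : Set X) :
    Set (Lp ℝ 2 μ) :=
  {g | ∃ w ∈ Λ, (g : X → ℝ) =ᵐ[μ] fun x => B.indicator (fun _ => (1 : ℝ)) (T w x)}

/-- A finite measurable partition of `X`. -/
def IsPartition (α : Finset (Set X)) : Prop :=
  (∀ A ∈ α, MeasurableSet A) ∧ ((α : Set (Set X)).PairwiseDisjoint id) ∧
    ⋃₀ (α : Set (Set X)) = Set.univ

/-- Static entropy `H_μ(α) = -∑ μ(A) log μ(A)`. -/
def partEnt (μ : Measure X) (α : Finset (Set X)) : ℝ :=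
  ∑ A ∈ α, Real.negMulLog (μ A).toReal

/-- The join `⋁_{i=1}^k T^{-w_i} α`. -/
def seqJoin (T : G → X → X) (w : ℕ → G) (α : Finset (Set X)) : ℕ → Finset (Set X)
  | 0 => {Set.univ}
  | k + 1 => ((seqJoin T w α k) ×ˢ α).image fun p => p.1 ∩ (T (w k) ⁻¹' p.2)

/-- Sequence entropy `h^S_μ(T, α)` along the sequence `w` for the partition `α`. -/
def seqEnt (μ : Measure X) (T : G → X → X) (w : ℕ → G) (α : Finset (Set X)) : ℝ :=
  Filter.atTop.limsup fun k : ℕ => partEnt μ (seqJoin T w α k) / (k : ℝ)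

/-- Sequence entropy `h^S_μ(T)`, as the supremum over all finite measurable
partitions (valued in `ℝ≥0∞`). -/
def seqEntSup (μ : Measure X) (T : G → X → X) (w : ℕ → G) : ℝ≥0∞ :=
  ⨆ α : {α : Finset (Set X) // IsPartition α}, ENNReal.ofReal (seqEnt μ T w α)

/-- `w : ℕ → G` is an enumeration of an infinite subset of `Λ`. -/
def EnumIn (w : ℕ → G) (Λ : Set G) : Prop :=
  Function.Injective w ∧ ∀ i, w i ∈ Λ

/-- Conditional entropy `H_μ(α | F)` with respect to a sub-σ-algebra `F`. -/
def condEntAlg (μ : Measure X) (F : MeasurableSpace X) (α : Finset (Set X)) : ℝ :=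
  ∑ A ∈ α, ∫ x, Real.negMulLog ((μ[A.indicator (fun _ => (1 : ℝ)) | F]) x) ∂μ

/-- Conditional entropy `H_μ(α | η)` of a partition given another partition. -/
def condEntPart (μ : Measure X) (α η : Finset (Set X)) : ℝ :=
  -∑ A ∈ α, ∑ D ∈ η,
    (μ (A ∩ D)).toReal * Real.log ((μ (A ∩ D)).toReal / (μ D).toReal)

/-- A `ℤ²`-measure-preserving system: an action of `ℤ²` by homeomorphisms
(continuous maps with continuous inverses `T (-w)`), preserving `μ`. -/
def IsZ2MPS [TopologicalSpace X] (μ : Measure X) (T : ℤ × ℤ → X → X) : Prop :=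
  (∀ w, Continuous (T w)) ∧ T 0 = _root_.id ∧ (∀ v w, T (v + w) = T v ∘ T w) ∧
    ∀ w, MeasurePreserving (T w) μ μ

/-- The strip `Λ^{(1,β)}(b) = {(m,n) : βm - b/2 ≤ n ≤ βm + b/2}`. -/
def Lam (β b : ℝ) : Set (ℤ × ℤ) :=
  {p | β * (p.1 : ℝ) - b / 2 ≤ (p.2 : ℝ) ∧ (p.2 : ℝ) ≤ β * (p.1 : ℝ) + b / 2}

/-- The `(1,β)`-directional Kronecker algebra with width parameter `b`. -/
def dirKron (μ : Measure X) (T : ℤ × ℤ → X → X) (β b : ℝ) : Set (Set X) :=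
  {B | MeasurableSet B ∧ IsCompact (closure (korbit μ T (Lam β b) B))}

/-- The directional Kronecker algebra as a σ-algebra (using width `b = 1`,
which is immaterial since `dirKron` is independent of `b`). -/
def dirKronAlg (μ : Measure X) (T : ℤ × ℤ → X → X) (β : ℝ) : MeasurableSpace X :=
  MeasurableSpace.generateFrom (dirKron μ T β 1)

/-- The classical Kronecker algebra of the `ℤ²`-system. -/
def kron (μ : Measure X) (T : ℤ × ℤ → X → X) : Set (Set X) :=
  {B | MeasurableSet B ∧ IsCompact (closure (korbit μ T Set.univ B))}

/-- `h^{v,*}_μ(α)`: supremum of directional sequence entropies of `α` over all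
infinite subsets of the strip (width `1`, immaterial). -/
def hStar (μ : Measure X) (T : ℤ × ℤ → X → X) (β : ℝ) (α : Finset (Set X)) : ℝ :=
  ⨆ w : {w : ℕ → ℤ × ℤ // EnumIn w (Lam β 1)}, seqEnt μ T w.1 α

end

section Entropy

theorem negMulLog_add_mul_log_le {a d q : ℝ} (ha : 0 ≤ a) (had : a ≤ d) (hq : 0 < q) :
    Real.negMulLog a + a * Real.log d + a * Real.log q ≤ d * q - a := by
  rcases ha.eq_or_lt with rfl | ha
  · simpa using mul_nonneg had hq.le
  have hd : 0 < d := ha.trans_le had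
  have h := Real.log_le_sub_one_of_pos (x := d * q / a) (by positivity)
  rw [Real.log_div (by positivity) ha.ne', Real.log_mul hd.ne' hq.ne'] at h
  have h2 := mul_le_mul_of_nonneg_left h ha.le
  have h3 : a * (d * q / a - 1) = d * q - a := by field_simp
  rw [h3] at h2
  simp only [Real.negMulLog]
  linarith

theorem negMulLog_sum_le {ι : Type*} (s : Finset ι) (a : ι → ℝ) (ha : ∀ i ∈ s, 0 ≤ a i) :
    Real.negMulLog (∑ i ∈ s, a i) ≤ ∑ i ∈ s, Real.negMulLog (a i) := by
  rw [Real.negMulLog, neg_mul, Finset.sum_mul, ← Finset.sum_neg_distrib]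
  refine Finset.sum_le_sum fun i hi => ?_
  rcases (ha i hi).eq_or_lt with h | h
  · simp [← h]
  have := Real.log_le_log h (Finset.single_le_sum ha hi)
  simp only [Real.negMulLog]
  nlinarith

theorem two_mul_sub_le_negMulLog {a b : ℝ} (ha : 0 ≤ a) (hb : 0 ≤ b) :
    2 * (a - a ^ 2 / (a + b)) ≤
      Real.negMulLog a + Real.negMulLog b - Real.negMulLog (a + b) := by
  rcases ha.eq_or_lt with rfl | ha
  · simp
  rcases hb.eq_or_lt with rfl | hb
  · simp [pow_two]
  have h1 := Real.log_le_sub_one_of_pos (x := a / (a + b)) (by positivity)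
  have h2 := Real.log_le_sub_one_of_pos (x := b / (a + b)) (by positivity)
  rw [Real.log_div (by positivity) (by positivity)] at h1 h2
  have h3 := mul_le_mul_of_nonneg_left h1 ha.le
  have h4 := mul_le_mul_of_nonneg_left h2 hb.le
  have h5 : 2 * (a - a ^ 2 / (a + b)) = -(a * (a / (a + b) - 1)) - b * (b / (a + b) - 1) := by
    field_simp
    ring
  rw [h5]
  simp only [Real.negMulLog]
  linarith

variable {X : Type*}

open Classical in
/-- The common refinement `η ∨ f⁻¹ α`. -/
noncomputable def refineBy (η : Finset (Set X)) (f : X → X) (α : Finset (Set X)) :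
    Finset (Set X) :=
  (η ×ˢ α).image fun p => p.1 ∩ f ⁻¹' p.2

theorem mem_refineBy {η α : Finset (Set X)} {f : X → X} {E : Set X} :
    E ∈ refineBy η f α ↔ ∃ D ∈ η, ∃ A ∈ α, D ∩ f ⁻¹' A = E := by
  simp only [refineBy, Finset.mem_image, Finset.mem_product, Prod.exists]
  grind

open Classical in
/-- The partition `{B, Bᶜ}`. -/
noncomputable def pairPartition (B : Set X) : Finset (Set X) := {B, Bᶜ}

theorem sum_pairPartition [Nonempty X] (B : Set X) (g : Set X → ℝ) :
    ∑ A ∈ pairPartition B, g A = g B + g Bᶜ := by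
  classical
  rw [pairPartition]
  convert Finset.sum_pair (ne_compl_self (a := B))

theorem seqJoin_succ {G : Type*} (T : G → X → X) (w : ℕ → G) (α : Finset (Set X)) (k : ℕ) :
    seqJoin T w α (k + 1) = refineBy (seqJoin T w α k) (T (w k)) α := rfl

variable [MeasurableSpace X]

theorem isPartition_univ : IsPartition ({Set.univ} : Finset (Set X)) := by
  simp [IsPartition]

theorem isPartition_pairPartition {B : Set X} (hB : MeasurableSet B) :
    IsPartition (pairPartition B) := by
  refine ⟨by simp [pairPartition, hB], ?_, by simp [pairPartition]⟩
  rw [pairPartition, Finset.coe_pair]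
  rintro C (rfl | rfl) D (rfl | rfl) h
  · exact absurd rfl h
  · exact disjoint_compl_right
  · exact disjoint_compl_left
  · exact absurd rfl h

theorem IsPartition.eq_of_mem {α : Finset (Set X)} (hα : IsPartition α) {A B : Set X}
    (hA : A ∈ α) (hB : B ∈ α) {x : X} (hxA : x ∈ A) (hxB : x ∈ B) : A = B := by
  by_contra h
  exact Set.disjoint_left.1 (hα.2.1 hA hB h) hxA hxB

theorem IsPartition.exists_mem {α : Finset (Set X)} (hα : IsPartition α) (x : X) :
    ∃ A ∈ α, x ∈ A := by
  have : x ∈ ⋃₀ (α : Set (Set X)) := hα.2.2 ▸ Set.mem_univ x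
  simpa using this

theorem IsPartition.refineBy {η α : Finset (Set X)} (hη : IsPartition η) (hα : IsPartition α)
    {f : X → X} (hf : Measurable f) : IsPartition (refineBy η f α) := by
  refine ⟨?_, ?_, ?_⟩
  · intro E hE
    obtain ⟨D, hD, A, hA, rfl⟩ := mem_refineBy.1 hE
    exact (hη.1 D hD).inter (hf (hα.1 A hA))
  · intro E hE F hF hEF
    obtain ⟨D, hD, A, hA, rfl⟩ := mem_refineBy.1 hE
    obtain ⟨D', hD', A', hA', rfl⟩ := mem_refineBy.1 hF
    refine Set.disjoint_left.2 fun x hx hx' => hEF ?_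
    rw [hη.eq_of_mem hD hD' hx.1 hx'.1, hα.eq_of_mem hA hA' hx.2 hx'.2]
  · refine Set.eq_univ_of_forall fun x => ?_
    obtain ⟨D, hD, hxD⟩ := hη.exists_mem x
    obtain ⟨A, hA, hxA⟩ := hα.exists_mem (f x)
    exact ⟨_, mem_refineBy.2 ⟨D, hD, A, hA, rfl⟩, hxD, hxA⟩

theorem IsPartition.seqJoin {G : Type*} {T : G → X → X} (hT : ∀ g, Measurable (T g))
    (w : ℕ → G) {α : Finset (Set X)} (hα : IsPartition α) (k : ℕ) :
    IsPartition (seqJoin T w α k) := by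
  induction k with
  | zero => exact isPartition_univ
  | succ k ih => exact ih.refineBy hα (hT _)

theorem partEnt_refineBy (μ : Measure X) {η α : Finset (Set X)} (hη : IsPartition η) (hα : IsPartition α)
    (f : X → X) :
    partEnt μ (refineBy η f α) =
      ∑ D ∈ η, ∑ A ∈ α, Real.negMulLog (μ.real (D ∩ f ⁻¹' A)) := by
  classical
  rw [partEnt, ← Finset.sum_product', refineBy]
  convert! Finset.sum_image_of_pairwise_eq_zero ?_
  rintro ⟨D, A⟩ h ⟨D', A'⟩ h' hne heq
  simp only [Finset.coe_product, Set.mem_prod, Finset.mem_coe] at h h'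
  have hemp : D ∩ f ⁻¹' A = ∅ := by
    by_contra hn
    obtain ⟨x, hx⟩ := Set.nonempty_iff_ne_empty.2 hn
    have hx' : x ∈ D' ∩ f ⁻¹' A' := by
      have := heq
      dsimp only at this
      rwa [← this]
    exact hne (Prod.ext (hη.eq_of_mem h.1 h'.1 hx.1 hx'.1) (hα.eq_of_mem h.2 h'.2 hx.2 hx'.2))
  simp [hemp]

variable (μ : Measure X) [IsProbabilityMeasure μ]

theorem IsPartition.sum_measureReal_inter {α : Finset (Set X)} (hα : IsPartition α)
    {f : X → X} (hf : Measurable f) (D : Set X) :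
    ∑ A ∈ α, μ.real (D ∩ f ⁻¹' A) = μ.real D := by
  have h := measureReal_biUnion_finset (μ := μ.restrict D) (s := α) (f := fun A => f ⁻¹' A)
    (fun A hA B hB hAB => (hα.2.1 hA hB hAB).preimage f) (fun A hA => hf (hα.1 A hA))
  have hU : ⋃ A ∈ α, f ⁻¹' A = Set.univ := by
    refine Set.eq_univ_of_forall fun x => ?_
    obtain ⟨A, hA, hxA⟩ := hα.exists_mem (f x)
    exact Set.mem_biUnion hA hxA
  rw [hU, measureReal_restrict_apply_univ] at h
  rw [h]
  refine Finset.sum_congr rfl fun A hA => ?_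
  rw [measureReal_restrict_apply (hf (hα.1 A hA)), Set.inter_comm]

theorem IsPartition.sum_measureReal_inter_id {η : Finset (Set X)} (hη : IsPartition η)
    (D : Set X) : ∑ A ∈ η, μ.real (A ∩ D) = μ.real D := by
  rw [← hη.sum_measureReal_inter μ measurable_id D]
  exact Finset.sum_congr rfl fun A _ => by rw [Set.inter_comm]; rfl

theorem IsPartition.sum_measureReal {η : Finset (Set X)} (hη : IsPartition η) :
    ∑ A ∈ η, μ.real A = 1 := by
  simpa using hη.sum_measureReal_inter_id μ Set.univ

/-- The Gibbs inequality for the conditional entropy of `f⁻¹ α` given `η`. -/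
theorem partEnt_refineBy_le {η α : Finset (Set X)} (hη : IsPartition η) (hα : IsPartition α)
    {f : X → X} (hf : Measurable f) (q : Set X → Set X → ℝ) (hq : ∀ D A, 0 < q D A)
    (hq1 : ∀ D ∈ η, ∑ A ∈ α, q D A ≤ 1) :
    partEnt μ (refineBy η f α) ≤
      partEnt μ η + ∑ D ∈ η, ∑ A ∈ α, μ.real (D ∩ f ⁻¹' A) * -Real.log (q D A) := by
  rw [partEnt_refineBy μ hη hα, partEnt, ← Finset.sum_add_distrib]
  refine Finset.sum_le_sum fun D hD => ?_
  have h := Finset.sum_le_sum fun A (_ : A ∈ α) => negMulLog_add_mul_log_le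
    (measureReal_nonneg (μ := μ) (s := D ∩ f ⁻¹' A))
    (measureReal_mono Set.inter_subset_left) (hq D A)
  simp only [Finset.sum_add_distrib, Finset.sum_sub_distrib, ← Finset.sum_mul,
    ← Finset.mul_sum, hα.sum_measureReal_inter μ hf D] at h
  have h2 := mul_le_mul_of_nonneg_left (hq1 D hD) (measureReal_nonneg (μ := μ) (s := D))
  simp only [mul_neg, Finset.sum_neg_distrib]
  change _ ≤ Real.negMulLog (μ.real D) + _
  simp only [Real.negMulLog] at h ⊢
  linarith

theorem partEnt_seqJoin_le {G : Type*} {T : G → X → X} (hT : ∀ g, Measurable (T g))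
    (w : ℕ → G) {α : Finset (Set X)} (hα : IsPartition α) (k : ℕ) :
    partEnt μ (seqJoin T w α k) ≤ k * Real.log (α.card + 1) := by
  induction k with
  | zero => simp [seqJoin, partEnt]
  | succ k ih =>
    have hη := IsPartition.seqJoin hT w hα k
    have h := partEnt_refineBy_le μ hη hα (hT (w k)) (fun _ _ => ((α.card : ℝ) + 1)⁻¹)
      (fun _ _ => by positivity) (fun _ _ => by
        rw [Finset.sum_const, nsmul_eq_mul, ← div_eq_mul_inv, div_le_one (by positivity)]
        linarith)
    simp only [Real.log_inv, neg_neg, ← Finset.sum_mul, hα.sum_measureReal_inter μ (hT (w k)),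
      hη.sum_measureReal μ] at h
    rw [seqJoin_succ]
    push_cast
    linarith

theorem partEnt_nonneg (η : Finset (Set X)) : 0 ≤ partEnt μ η :=
  Finset.sum_nonneg fun _ _ => Real.negMulLog_nonneg measureReal_nonneg measureReal_le_one

theorem partEnt_le_of_refines {η ζ : Finset (Set X)} (hη : IsPartition η) (hζ : IsPartition ζ)
    (h : ∀ D ∈ ζ, ∃ E ∈ η, D ⊆ E) : partEnt μ η ≤ partEnt μ ζ := by
  calc partEnt μ η ≤ ∑ E ∈ η, ∑ D ∈ ζ, Real.negMulLog (μ.real (D ∩ E)) := by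
        refine Finset.sum_le_sum fun E _ => ?_
        refine le_trans (le_of_eq ?_) (negMulLog_sum_le ζ _ fun _ _ => measureReal_nonneg)
        rw [hζ.sum_measureReal_inter_id μ]
        rfl
    _ = ∑ D ∈ ζ, ∑ E ∈ η, Real.negMulLog (μ.real (D ∩ E)) := Finset.sum_comm
    _ ≤ partEnt μ ζ := by
        refine Finset.sum_le_sum fun D hD => ?_
        obtain ⟨E, hE, hDE⟩ := h D hD
        rw [Finset.sum_eq_single_of_mem E hE, Set.inter_eq_left.2 hDE]
        · rfl
        intro F hF hFE
        have : D ∩ F = ∅ := Set.disjoint_iff_inter_eq_empty.1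
          ((hη.2.1 hE hF hFE.symm).mono_left hDE)
        simp [this]

/-- If `η` refines `g⁻¹ α` and `f⁻¹ α` is close to `g⁻¹ α`, then `f⁻¹ α` has small
conditional entropy given `η`. -/
theorem partEnt_refineBy_le_of_close {η α : Finset (Set X)} (hη : IsPartition η)
    (hα : IsPartition α) {f g : X → X} (hf : Measurable f)
    (hηg : ∀ D ∈ η, ∃ A ∈ α, D ⊆ g ⁻¹' A) {s δ : ℝ} (hs : 0 < s) (hs1 : s < 1)
    (hδ : ∑ A ∈ α, μ.real (g ⁻¹' A \ f ⁻¹' A) ≤ δ) :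
    partEnt μ (refineBy η f α) ≤
      partEnt μ η + (-Real.log (1 - s) + δ * -Real.log (s / (α.card + 1))) := by
  classical
  choose! A₀ hA₀ hDA using hηg
  set r : ℝ := α.card + 1 with hr
  have hr1 : 1 ≤ r := by simp [hr]
  have hL : 0 ≤ -Real.log (s / r) := by
    rw [neg_nonneg]
    exact Real.log_nonpos (by positivity) ((div_le_one (by linarith)).2 (by linarith))
  have hL1 : 0 ≤ -Real.log (1 - s) := by
    rw [neg_nonneg]
    exact Real.log_nonpos (by linarith) (by linarith)
  have hq := partEnt_refineBy_le μ hη hα hf (fun D A => if A = A₀ D then 1 - s else s / r)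
    (fun D A => by split_ifs <;> [linarith; positivity]) (fun D hD => by
      rw [← Finset.add_sum_erase _ _ (hA₀ D hD), if_pos rfl,
        Finset.sum_congr rfl (g := fun _ => s / r)
          (fun A hA => if_neg (Finset.ne_of_mem_erase hA)),
        Finset.sum_const, nsmul_eq_mul]
      have h1 : (((α.erase (A₀ D)).card : ℕ) : ℝ) ≤ r := by
        have : (α.erase (A₀ D)).card ≤ α.card := Finset.card_le_card (Finset.erase_subset _ _)
        have : ((α.erase (A₀ D)).card : ℝ) ≤ α.card := by exact_mod_cast this
        linarith
      have h2 : ((α.erase (A₀ D)).card : ℝ) * (s / r) ≤ r * (s / r) := by gcongr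
      have h3 : r * (s / r) = s := by field_simp
      linarith)
  refine hq.trans (add_le_add le_rfl ?_)
  have hD : ∀ D ∈ η, ∑ A ∈ α, μ.real (D ∩ f ⁻¹' A) *
      -Real.log (if A = A₀ D then 1 - s else s / r) ≤
      μ.real D * -Real.log (1 - s) + (∑ A ∈ α, μ.real (D ∩ (g ⁻¹' A \ f ⁻¹' A))) *
        -Real.log (s / r) := by
    intro D hD
    have hsum := hα.sum_measureReal_inter μ hf D
    have hle : μ.real (D ∩ (g ⁻¹' A₀ D \ f ⁻¹' A₀ D)) ≤
        ∑ A ∈ α, μ.real (D ∩ (g ⁻¹' A \ f ⁻¹' A)) :=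
      Finset.single_le_sum (f := fun A => μ.real (D ∩ (g ⁻¹' A \ f ⁻¹' A)))
        (fun _ _ => measureReal_nonneg) (hA₀ D hD)
    have heq : D ∩ (g ⁻¹' A₀ D \ f ⁻¹' A₀ D) = D \ f ⁻¹' A₀ D := by
      have := hDA D hD
      grind
    have hdiff := measureReal_sdiff_add_inter (μ := μ) (s := D) (hf (hα.1 _ (hA₀ D hD)))
    rw [heq] at hle
    rw [← Finset.add_sum_erase _ _ (hA₀ D hD)] at hsum
    rw [← Finset.add_sum_erase _ _ (hA₀ D hD), if_pos rfl,
      Finset.sum_congr rfl (g := fun A => μ.real (D ∩ f ⁻¹' A) * -Real.log (s / r))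
        (fun A hA => by rw [if_neg (Finset.ne_of_mem_erase hA)]), ← Finset.sum_mul]
    refine add_le_add ?_ ?_
    · exact mul_le_mul_of_nonneg_right (measureReal_mono Set.inter_subset_left) hL1
    · exact mul_le_mul_of_nonneg_right (by linarith) hL
  refine (Finset.sum_le_sum hD).trans ?_
  rw [Finset.sum_add_distrib, ← Finset.sum_mul, ← Finset.sum_mul, hη.sum_measureReal μ, one_mul,
    Finset.sum_comm]
  simp only [hη.sum_measureReal_inter_id μ]
  exact add_le_add le_rfl (mul_le_mul_of_nonneg_right hδ hL)

end Entropy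

section Hilbert

variable {H : Type*} [NormedAddCommGroup H] [InnerProductSpace ℝ H]

/-- The Bessel inequality for an orthogonal, not necessarily normalized, family. -/
theorem sum_inner_sq_div_le {ι : Type*} (s : Finset ι) (e : ι → H)
    (he : ∀ i ∈ s, ∀ j ∈ s, i ≠ j → inner ℝ (e i) (e j) = 0) (f : H) :
    ∑ i ∈ s, inner ℝ f (e i) ^ 2 / ‖e i‖ ^ 2 ≤ ‖f‖ ^ 2 := by
  set t : ι → ℝ := fun i => inner ℝ f (e i) / ‖e i‖ ^ 2 with ht
  have h := norm_sub_sq_real f (∑ i ∈ s, t i • e i)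
  have h1 : inner ℝ f (∑ i ∈ s, t i • e i) = ∑ i ∈ s, inner ℝ f (e i) ^ 2 / ‖e i‖ ^ 2 := by
    rw [inner_sum]
    refine Finset.sum_congr rfl fun i _ => ?_
    rw [inner_smul_right, ht]
    ring
  have h2 : ‖∑ i ∈ s, t i • e i‖ ^ 2 = ∑ i ∈ s, inner ℝ f (e i) ^ 2 / ‖e i‖ ^ 2 := by
    rw [← real_inner_self_eq_norm_sq, sum_inner]
    refine Finset.sum_congr rfl fun i hi => ?_
    rw [inner_sum, Finset.sum_eq_single_of_mem i hi, inner_smul_left, inner_smul_right,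
      real_inner_self_eq_norm_sq]
    · by_cases h0 : ‖e i‖ = 0
      · simp [h0]
      · simp only [ht, conj_trivial]
        field_simp
    · intro j hj hji
      rw [inner_smul_left, inner_smul_right, he i hi j hj hji.symm, mul_zero, mul_zero]
  rw [h1, h2] at h
  nlinarith [sq_nonneg ‖f - ∑ i ∈ s, t i • e i‖]

/-- A separated sequence on a sphere has a weak cluster point of strictly smaller norm. -/
theorem exists_weak_limit_of_separated [CompleteSpace H] (u : ℕ → H) {m ε : ℝ}
    (hu : ∀ i, ‖u i‖ ^ 2 = m) (hε : 0 < ε) (hsep : ∀ i j, i ≠ j → ε ≤ ‖u i - u j‖) :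
    ∃ f : H, (∀ e, Tendsto (fun i => inner ℝ (u i) e) (hyperfilter ℕ) (𝓝 (inner ℝ f e))) ∧
      ‖f‖ ^ 2 ≤ m - ε ^ 2 / 2 := by
  have hcomp := WeakDual.isCompact_closedBall (𝕜 := ℝ) (E := H) 0 (Real.sqrt m)
  let φ : ℕ → WeakDual ℝ H := fun n => StrongDual.toWeakDual (InnerProductSpace.toDual ℝ H (u n))
  obtain ⟨F, -, hF⟩ := hcomp.ultrafilter_le_nhds ((hyperfilter ℕ).map φ) (by
    rw [Ultrafilter.coe_map, le_principal_iff, mem_map]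
    refine Filter.univ_mem' fun n => ?_
    change InnerProductSpace.toDual ℝ H (u n) ∈ Metric.closedBall 0 _
    rw [mem_closedBall_zero_iff, LinearIsometryEquiv.norm_map, ← hu n,
      Real.sqrt_sq (norm_nonneg _)])
  have hF' : Tendsto φ (hyperfilter ℕ) (𝓝 F) := by
    rwa [Ultrafilter.coe_map] at hF
  have hlim : ∀ e, Tendsto (fun i => inner ℝ (u i) e) (hyperfilter ℕ)
      (𝓝 (inner ℝ ((InnerProductSpace.toDual ℝ H).symm (WeakDual.toStrongDual F)) e)) := by
    intro e
    have h := ((WeakDual.eval_continuous e).tendsto F).comp hF'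
    rw [InnerProductSpace.toDual_symm_apply]
    exact h
  refine ⟨_, hlim, ?_⟩
  set f := (InnerProductSpace.toDual ℝ H).symm (WeakDual.toStrongDual F)
  have hfu : ∀ i, inner ℝ f (u i) ≤ m - ε ^ 2 / 2 := by
    intro i
    refine le_of_tendsto (hlim (u i)) ?_
    have hne : ∀ᶠ j in (hyperfilter ℕ : Filter ℕ), j ≠ i :=
      hyperfilter_le_cofinite (Set.finite_singleton i).compl_mem_cofinite
    filter_upwards [hne] with j hj
    have h1 := norm_sub_sq_real (u j) (u i)
    have h2 := pow_le_pow_left₀ hε.le (hsep j i hj) 2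
    rw [hu, hu] at h1
    linarith
  rw [← real_inner_self_eq_norm_sq]
  refine le_of_tendsto (hlim f) (Eventually.of_forall fun i => ?_)
  rw [real_inner_comm]
  exact hfu i

end Hilbert

section Indicator

variable {X : Type*} [MeasurableSpace X] (μ : Measure X) [IsProbabilityMeasure μ]

open Classical in
/-- The indicator function of `C` as an element of `L²(μ)` (zero if `C` is not measurable). -/
noncomputable def indL2 (C : Set X) : Lp ℝ 2 μ :=
  if hC : MeasurableSet C then indicatorConstLp 2 hC (measure_ne_top μ C) 1 else 0

theorem coeFn_indL2 {C : Set X} (hC : MeasurableSet C) :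
    indL2 μ C =ᵐ[μ] C.indicator fun _ => (1 : ℝ) := by
  rw [indL2, dif_pos hC]
  exact indicatorConstLp_coeFn

theorem inner_indL2 {C D : Set X} (hC : MeasurableSet C) (hD : MeasurableSet D) :
    inner ℝ (indL2 μ C) (indL2 μ D) = μ.real (C ∩ D) := by
  rw [indL2, indL2, dif_pos hC, dif_pos hD,
    L2.real_inner_indicatorConstLp_one_indicatorConstLp_one]

theorem norm_indL2_sq {C : Set X} (hC : MeasurableSet C) : ‖indL2 μ C‖ ^ 2 = μ.real C := by
  rw [← real_inner_self_eq_norm_sq, inner_indL2 μ hC hC, Set.inter_self]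

theorem measureReal_diff_le_norm_sq {C D : Set X} (hC : MeasurableSet C)
    (hD : MeasurableSet D) : μ.real (C \ D) ≤ ‖indL2 μ C - indL2 μ D‖ ^ 2 := by
  have h1 := measureReal_sdiff_add_inter (μ := μ) (s := C) hD
  have h2 : μ.real (C ∩ D) ≤ μ.real D := measureReal_mono Set.inter_subset_right
  rw [norm_sub_sq_real, norm_indL2_sq μ hC, norm_indL2_sq μ hD, inner_indL2 μ hC hD]
  linarith

theorem korbit_eq_image {G : Type*} {T : G → X → X} (hT : ∀ g, Measurable (T g)) (Λ : Set G)
    {B : Set X} (hB : MeasurableSet B) :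
    korbit μ T Λ B = (fun g => indL2 μ (T g ⁻¹' B)) '' Λ := by
  ext g
  have key : ∀ w, (indL2 μ (T w ⁻¹' B) : X → ℝ) =ᵐ[μ]
      fun x => B.indicator (fun _ => (1 : ℝ)) (T w x) := fun w => coeFn_indL2 μ (hT w hB)
  constructor
  · rintro ⟨w, hw, h⟩
    exact ⟨w, hw, Lp.ext ((key w).trans h.symm)⟩
  · rintro ⟨w, hw, rfl⟩
    exact ⟨w, hw, key w⟩

end Indicator

section PositiveEntropy

variable {X : Type*} [MeasurableSpace X] (μ : Measure X) [IsProbabilityMeasure μ]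

theorem sum_inner_indL2_sq_div_le {η : Finset (Set X)} (hη : IsPartition η) (f : Lp ℝ 2 μ) :
    ∑ D ∈ η, inner ℝ f (indL2 μ D) ^ 2 / μ.real D ≤ ‖f‖ ^ 2 := by
  refine le_trans (le_of_eq (Finset.sum_congr rfl fun D hD => ?_))
    (sum_inner_sq_div_le η (indL2 μ) (fun D hD E hE hDE => ?_) f)
  · rw [norm_indL2_sq μ (hη.1 D hD)]
  · rw [inner_indL2 μ (hη.1 D hD) (hη.1 E hE),
      show D ∩ E = ∅ from Set.disjoint_iff_inter_eq_empty.1 (hη.2.1 hD hE hDE),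
      measureReal_empty]

theorem partEnt_add_le_refineBy_pairPartition {η : Finset (Set X)} (hη : IsPartition η)
    {B : Set X} (hB : MeasurableSet B) {f : X → X} (hf : MeasurePreserving f μ μ) :
    partEnt μ η + 2 * (μ.real B - ∑ D ∈ η, μ.real (f ⁻¹' B ∩ D) ^ 2 / μ.real D) ≤
      partEnt μ (refineBy η f (pairPartition B)) := by
  have := nonempty_of_isProbabilityMeasure μ
  have hmB : μ.real B = ∑ D ∈ η, μ.real (f ⁻¹' B ∩ D) := by
    rw [← hf.measureReal_preimage hB.nullMeasurableSet, ← hη.sum_measureReal_inter_id μ]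
    exact Finset.sum_congr rfl fun D _ => by rw [Set.inter_comm]
  rw [partEnt_refineBy μ hη (isPartition_pairPartition hB), partEnt, hmB,
    ← Finset.sum_sub_distrib, Finset.mul_sum, ← Finset.sum_add_distrib]
  refine Finset.sum_le_sum fun D _ => ?_
  have hsplit : μ.real (f ⁻¹' B ∩ D) + μ.real (D ∩ f ⁻¹' Bᶜ) = μ.real D := by
    rw [Set.inter_comm, Set.preimage_compl, ← Set.sdiff_eq]
    exact measureReal_inter_add_sdiff (hf.measurable hB)
  have h := two_mul_sub_le_negMulLog (measureReal_nonneg (μ := μ) (s := f ⁻¹' B ∩ D))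
    (measureReal_nonneg (μ := μ) (s := D ∩ f ⁻¹' Bᶜ))
  rw [hsplit] at h
  rw [sum_pairPartition, Set.inter_comm D (f ⁻¹' B)]
  change Real.negMulLog (μ.real D) + _ ≤ _
  linarith

theorem eventually_partEnt_refineBy_ge {η : Finset (Set X)} (hη : IsPartition η)
    {B : Set X} (hB : MeasurableSet B) (F : ℕ → X → X) (hF : ∀ i, MeasurePreserving (F i) μ μ)
    {f : Lp ℝ 2 μ} {c : ℝ} (hc : 0 < c)
    (hlim : ∀ e, Tendsto (fun i => inner ℝ (indL2 μ (F i ⁻¹' B)) e) (hyperfilter ℕ)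
      (𝓝 (inner ℝ f e)))
    (hf : ‖f‖ ^ 2 ≤ μ.real B - c) :
    ∀ᶠ i in (hyperfilter ℕ : Filter ℕ),
      partEnt μ η + c ≤ partEnt μ (refineBy η (F i) (pairPartition B)) := by
  have hsum : Tendsto (fun i => ∑ D ∈ η, μ.real (F i ⁻¹' B ∩ D) ^ 2 / μ.real D)
      (hyperfilter ℕ) (𝓝 (∑ D ∈ η, inner ℝ f (indL2 μ D) ^ 2 / μ.real D)) := by
    refine tendsto_finsetSum η fun D hD => ?_
    refine Tendsto.div_const (Tendsto.pow ?_ 2) _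
    refine (hlim (indL2 μ D)).congr fun i => ?_
    rw [inner_indL2 μ ((hF i).measurable hB) (hη.1 D hD)]
  have hlt : ∑ D ∈ η, inner ℝ f (indL2 μ D) ^ 2 / μ.real D < μ.real B - c / 2 :=
    ((sum_inner_indL2_sq_div_le μ hη f).trans hf).trans_lt (by linarith)
  filter_upwards [hsum.eventually_lt_const hlt] with i hi
  have := partEnt_add_le_refineBy_pairPartition μ hη hB (hF i)
  linarith

theorem exists_separated_seq {M G : Type*} [SeminormedAddCommGroup M] (φ : G → M) {Λ : Set G}
    (h : ¬ TotallyBounded (φ '' Λ)) :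
    ∃ ε > 0, ∃ u : ℕ → G, (∀ i, u i ∈ Λ) ∧ ∀ i j, i ≠ j → ε ≤ ‖φ (u i) - φ (u j)‖ := by
  simp only [Metric.totallyBounded_iff, not_forall, not_exists, not_and] at h
  obtain ⟨ε, hε, h⟩ := h
  have : Std.Symm fun a b : G => ε ≤ ‖φ a - φ b‖ := ⟨fun a b hab => by rwa [norm_sub_rev]⟩
  obtain ⟨u, hu, hsep⟩ := exists_seq_of_forall_finset_exists' (fun g : G => g ∈ Λ)
    (fun a b => ε ≤ ‖φ a - φ b‖) (by
      intro s _
      obtain ⟨x, ⟨g, hg, rfl⟩, hx⟩ :=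
        Set.not_subset.1 (h (φ '' (s : Set G)) (s.finite_toSet.image φ))
      refine ⟨g, hg, fun a ha => ?_⟩
      by_contra! hlt
      refine hx (Set.mem_biUnion (Set.mem_image_of_mem φ ha) ?_)
      rwa [Metric.mem_ball, dist_comm, dist_eq_norm])
  exact ⟨ε, hε, u, hu, fun i j hij => hsep hij⟩

/-- A greedy choice: if every partition can be refined by infinitely many of the `T (u i)` with
a definite gain of entropy, then some subsequence of `u` has linearly growing entropy. -/
theorem exists_subseq_partEnt_ge {G : Type*} {T : G → X → X} (hT : ∀ g, Measurable (T g))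
    {α : Finset (Set X)} (hα : IsPartition α) (u : ℕ → G) {c : ℝ}
    (h : ∀ η : Finset (Set X), IsPartition η → ∀ n : ℕ, ∃ i > n,
      partEnt μ η + c ≤ partEnt μ (refineBy η (T (u i)) α)) :
    ∃ σ : ℕ → ℕ, StrictMono σ ∧ ∀ k : ℕ, k * c ≤ partEnt μ (seqJoin T (u ∘ σ) α k) := by
  choose! next hnext_gt hnext using h
  let step : ℕ × Finset (Set X) → ℕ × Finset (Set X) := fun p =>
    (next p.2 p.1, refineBy p.2 (T (u (next p.2 p.1))) α)
  let s : ℕ → ℕ × Finset (Set X) := fun k => step^[k] (0, {Set.univ})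
  have hs : ∀ k, s (k + 1) = step (s k) := fun k => Function.iterate_succ_apply' _ _ _
  have hs2 : ∀ k, seqJoin T (u ∘ fun k => (s (k + 1)).1) α k = (s k).2 := by
    intro k
    induction k with
    | zero => rfl
    | succ k ih => rw [seqJoin_succ, ih, Function.comp_apply, hs k]
  have hpart : ∀ k, IsPartition (s k).2 := fun k => by
    rw [← hs2]
    exact IsPartition.seqJoin hT _ hα k
  refine ⟨fun k => (s (k + 1)).1, strictMono_nat_of_lt_succ fun k => ?_, fun k => ?_⟩
  · rw [hs (k + 1)]
    exact hnext_gt _ (hpart _) _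
  · rw [hs2]
    induction k with
    | zero => simpa using partEnt_nonneg μ _
    | succ k ih =>
      have := hnext _ (hpart k) (s k).1
      rw [hs]
      push_cast
      simp only [step]
      linarith

theorem le_seqEnt {G : Type*} {T : G → X → X} (hT : ∀ g, Measurable (T g)) {w : ℕ → G}
    {α : Finset (Set X)} (hα : IsPartition α) {c : ℝ}
    (h : ∀ k : ℕ, k * c ≤ partEnt μ (seqJoin T w α k)) : c ≤ seqEnt μ T w α := by
  refine le_limsup_of_le ?_ fun b hb => ?_
  · refine isBoundedUnder_of_eventually_le (a := Real.log (α.card + 1)) ?_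
    filter_upwards [eventually_gt_atTop 0] with k hk
    rw [div_le_iff₀ (by exact_mod_cast hk), mul_comm]
    exact partEnt_seqJoin_le μ hT w hα k
  · obtain ⟨k, hk, hk0⟩ := (hb.and (eventually_gt_atTop 0)).exists
    refine le_trans ?_ hk
    rw [le_div_iff₀ (by exact_mod_cast hk0), mul_comm]
    exact h k

/-- A measurable set whose orbit along `Λ` is not totally bounded yields a sequence in `Λ` of
positive sequence entropy. -/
theorem exists_seqEntSup_ne_zero {G : Type*} {T : G → X → X}
    (hT : ∀ g, MeasurePreserving (T g) μ μ) {Λ : Set G} {B : Set X} (hB : MeasurableSet B)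
    (h : ¬ TotallyBounded ((fun g => indL2 μ (T g ⁻¹' B)) '' Λ)) :
    ∃ w : ℕ → G, EnumIn w Λ ∧ seqEntSup μ T w ≠ 0 := by
  obtain ⟨ε, hε, u, hu, hsep⟩ := exists_separated_seq _ h
  obtain ⟨f, hlim, hf⟩ := exists_weak_limit_of_separated (m := μ.real B)
    (fun i => indL2 μ (T (u i) ⁻¹' B)) (fun i => by
      rw [norm_indL2_sq μ ((hT _).measurable hB),
        (hT _).measureReal_preimage hB.nullMeasurableSet]) hε hsep
  have hinj : Function.Injective u := by
    intro i j hij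
    by_contra hne
    have := hsep i j hne
    rw [hij, sub_self, norm_zero] at this
    exact this.not_gt hε
  have hα := isPartition_pairPartition hB
  obtain ⟨σ, hσ, hent⟩ := exists_subseq_partEnt_ge μ (fun g => (hT g).measurable) hα u
    (c := ε ^ 2 / 2) (fun η hη n => by
      have hn : ∀ᶠ i in (hyperfilter ℕ : Filter ℕ), i > n := by
        refine hyperfilter_le_cofinite ?_
        rw [Nat.cofinite_eq_atTop]
        exact eventually_gt_atTop n
      exact (hn.and (eventually_partEnt_refineBy_ge μ hη hB (fun i => T (u i))
        (fun i => hT _) (by positivity) hlim hf)).exists)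
  refine ⟨u ∘ σ, ⟨hinj.comp hσ.injective, fun i => hu _⟩, fun h0 => ?_⟩
  have h1 := le_seqEnt μ (fun g => (hT g).measurable) hα hent
  have h2 := ENNReal.iSup_eq_zero.1 h0 ⟨_, hα⟩
  rw [ENNReal.ofReal_eq_zero] at h2
  have : 0 < ε ^ 2 / 2 := by positivity
  linarith

end PositiveEntropy

section ZeroEntropy

variable {X : Type*} {G : Type*}

theorem exists_subset_of_mem_seqJoin {T : G → X → X} {w : ℕ → G} {α : Finset (Set X)} {k : ℕ}
    {D : Set X} (hD : D ∈ seqJoin T w α k) {i : ℕ} (hi : i < k) :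
    ∃ A ∈ α, D ⊆ T (w i) ⁻¹' A := by
  induction k generalizing D with
  | zero => omega
  | succ k ih =>
    rw [seqJoin_succ, mem_refineBy] at hD
    obtain ⟨E, hE, A, hA, rfl⟩ := hD
    rcases Nat.lt_succ_iff_lt_or_eq.1 hi with h | rfl
    · obtain ⟨A', hA', h'⟩ := ih hE h
      exact ⟨A', hA', Set.inter_subset_left.trans h'⟩
    · exact ⟨A, hA, Set.inter_subset_right⟩

theorem exists_subset_seqJoin_of_shift {T : G → X → X} {w w' : ℕ → G} {N : ℕ}
    (hw : ∀ i, w' (N + i) = w i) {α : Finset (Set X)} {k : ℕ} {D : Set X}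
    (hD : D ∈ seqJoin T w' α (N + k)) : ∃ E ∈ seqJoin T w α k, D ⊆ E := by
  induction k generalizing D with
  | zero => exact ⟨Set.univ, Finset.mem_singleton_self _, Set.subset_univ _⟩
  | succ k ih =>
    rw [← add_assoc, seqJoin_succ, mem_refineBy] at hD
    obtain ⟨D', hD', A, hA, rfl⟩ := hD
    obtain ⟨E, hE, hDE⟩ := ih hD'
    rw [hw]
    exact ⟨_, mem_refineBy.2 ⟨E, hE, A, hA, rfl⟩, Set.inter_subset_inter_left _ hDE⟩

theorem exists_finset_net {M ι : Type*} [PseudoMetricSpace M] [CompleteSpace M] (s : Finset ι)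
    (φ : G → ι → M) {Λ : Set G} (h : ∀ i ∈ s, TotallyBounded ((fun g => φ g i) '' Λ))
    {d : ℝ} (hd : 0 < d) :
    ∃ t : Finset G, ∀ g ∈ Λ, ∃ v ∈ t, ∀ i ∈ s, dist (φ g i) (φ v i) < d := by
  let Φ : G → s → M := fun g i => φ g i
  have hK : IsCompact (Set.univ.pi fun i : s => closure ((fun g => φ g i) '' Λ)) :=
    isCompact_univ_pi fun i => (h i i.2).closure.isCompact_of_isClosed isClosed_closure
  have hΦ : TotallyBounded (Φ '' Λ) := hK.totallyBounded.subset (by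
    rintro _ ⟨g, hg, rfl⟩ i -
    exact subset_closure ⟨g, hg, rfl⟩)
  obtain ⟨t, htΛ, htf, ht⟩ := Metric.finite_approx_of_totallyBounded hΦ d hd
  obtain ⟨t', -, ht'f, rfl⟩ := Set.exists_subset_image_finite_and.1 ⟨t, htΛ, htf, rfl⟩
  refine ⟨ht'f.toFinset, fun g hg => ?_⟩
  obtain ⟨_, ⟨v, hv, rfl⟩, hgv⟩ := Set.mem_iUnion₂.1 (ht ⟨g, hg, rfl⟩)
  exact ⟨v, by simpa using hv, fun i hi => (dist_pi_lt_iff hd).1 hgv ⟨i, hi⟩⟩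

variable [MeasurableSpace X] (μ : Measure X) [IsProbabilityMeasure μ]

/-- If all atoms of `α` have totally bounded orbits along `Λ`, the entropy of `α` along
sequences in `Λ` grows slower than any linear function. -/
theorem exists_partEnt_seqJoin_le {T : G → X → X} (hT : ∀ g, Measurable (T g)) {Λ : Set G}
    {α : Finset (Set X)} (hα : IsPartition α)
    (h : ∀ A ∈ α, TotallyBounded ((fun g => indL2 μ (T g ⁻¹' A)) '' Λ)) {w : ℕ → G}
    (hw : ∀ i, w i ∈ Λ) {ε : ℝ} (hε : 0 < ε) :
    ∃ C, ∀ k : ℕ, partEnt μ (seqJoin T w α k) ≤ C + k * ε := by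
  obtain ⟨s, hs, hs1, hslog⟩ : ∃ s : ℝ, 0 < s ∧ s < 1 ∧ -Real.log (1 - s) = ε / 2 := by
    refine ⟨1 - Real.exp (-(ε / 2)), ?_, ?_, ?_⟩
    · rw [sub_pos, Real.exp_lt_one_iff]
      linarith
    · linarith [Real.exp_pos (-(ε / 2))]
    · rw [sub_sub_cancel, Real.log_exp, neg_neg]
  set K := -Real.log (s / (α.card + 1)) with hK
  obtain ⟨δ, hδ, hδK⟩ : ∃ δ : ℝ, 0 < δ ∧ δ * K ≤ ε / 2 := by
    refine ⟨ε / 2 / (|K| + 1), by positivity, ?_⟩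
    rw [div_mul_eq_mul_div, div_le_iff₀ (by positivity)]
    nlinarith [le_abs_self K]
  set d := Real.sqrt (δ / (α.card + 1)) with hd
  have hd0 : 0 < d := Real.sqrt_pos.2 (by positivity)
  have hdsq : d ^ 2 = δ / (α.card + 1) := Real.sq_sqrt (by positivity)
  obtain ⟨t, ht⟩ := exists_finset_net α (fun g A => indL2 μ (T g ⁻¹' A)) h hd0
  let N := t.card
  let w' : ℕ → G := fun n => if hn : n < N then t.equivFin.symm ⟨n, hn⟩ else w (n - N)
  have hshift : ∀ i, w' (N + i) = w i := fun i => by simp [w']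
  refine ⟨partEnt μ (seqJoin T w' α N), fun k => ?_⟩
  refine (partEnt_le_of_refines μ (IsPartition.seqJoin hT w hα k)
    (IsPartition.seqJoin hT w' hα (N + k))
    fun D hD => exists_subset_seqJoin_of_shift hshift hD).trans ?_
  induction k with
  | zero => simp
  | succ k ih =>
    obtain ⟨v, hv, hvd⟩ := ht (w k) (hw k)
    have hvw : w' (t.equivFin ⟨v, hv⟩) = v := by simp [w', N]
    have hclose : ∑ A ∈ α, μ.real (T v ⁻¹' A \ T (w k) ⁻¹' A) ≤ δ := by
      calc ∑ A ∈ α, μ.real (T v ⁻¹' A \ T (w k) ⁻¹' A) ≤ ∑ _A ∈ α, d ^ 2 := by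
            refine Finset.sum_le_sum fun A hA => ?_
            refine (measureReal_diff_le_norm_sq μ (hT v (hα.1 A hA))
              (hT (w k) (hα.1 A hA))).trans ?_
            rw [norm_sub_rev, ← dist_eq_norm]
            exact pow_le_pow_left₀ dist_nonneg (hvd A hA).le 2
        _ ≤ δ := by
            rw [Finset.sum_const, nsmul_eq_mul, hdsq, mul_div_assoc', div_le_iff₀ (by positivity)]
            nlinarith
    have hstep := partEnt_refineBy_le_of_close μ (IsPartition.seqJoin hT w' hα (N + k)) hα
      (hT (w k)) (g := T v) (fun D hD => by
        rw [← hvw]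
        exact exists_subset_of_mem_seqJoin hD
          ((t.equivFin ⟨v, hv⟩).2.trans_le (Nat.le_add_right _ _))) hs hs1 hclose
    rw [← add_assoc, seqJoin_succ, hshift]
    push_cast
    linarith

theorem seqEntSup_eq_zero {T : G → X → X} (hT : ∀ g, Measurable (T g)) {Λ : Set G}
    (h : ∀ A, MeasurableSet A → TotallyBounded ((fun g => indL2 μ (T g ⁻¹' A)) '' Λ))
    {w : ℕ → G} (hw : ∀ i, w i ∈ Λ) : seqEntSup μ T w = 0 := by
  refine ENNReal.iSup_eq_zero.2 fun α => ENNReal.ofReal_eq_zero.2 ?_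
  refine le_of_forall_pos_le_add fun ε hε => ?_
  rw [zero_add]
  obtain ⟨C, hC⟩ := exists_partEnt_seqJoin_le μ hT α.2 (fun A hA => h A (α.2.1 A hA)) hw
    (half_pos hε)
  refine limsup_le_of_le ?_ ?_
  · exact (isBoundedUnder_of_eventually_ge (a := 0) (Eventually.of_forall fun k =>
      div_nonneg (partEnt_nonneg μ _) k.cast_nonneg)).isCoboundedUnder_le
  · filter_upwards [eventually_gt_atTop 0, eventually_ge_atTop ⌈C / (ε / 2)⌉₊] with k hk hkC
    have hk0 : (0 : ℝ) < k := by exact_mod_cast hk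
    rw [div_le_iff₀ hk0]
    have h1 := (div_le_iff₀ (half_pos hε)).1 (Nat.ceil_le.1 hkC)
    linarith [hC k]

end ZeroEntropy

section Strip

variable {X : Type*} [MeasurableSpace X] (μ : Measure X) [IsProbabilityMeasure μ]

theorem korbit_isCompact_closure_iff {G : Type*} {T : G → X → X} (hT : ∀ g, Measurable (T g))
    {Λ : Set G} {B : Set X} (hB : MeasurableSet B) :
    IsCompact (closure (korbit μ T Λ B)) ↔
      TotallyBounded ((fun g => indL2 μ (T g ⁻¹' B)) '' Λ) := by
  rw [korbit_eq_image μ hT Λ hB]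
  exact ⟨fun h => h.totallyBounded.subset subset_closure,
    fun h => h.closure.isCompact_of_isClosed isClosed_closure⟩

/-- Every element of a strip is a vertical translate, by a bounded amount, of an element of the
strip of width one. -/
theorem exists_vertical_translate {β b : ℝ} {p : ℤ × ℤ} (hp : p ∈ Lam β b) :
    ∃ j ∈ Set.Icc (-⌈b / 2 + 1 / 2⌉) ⌈b / 2 + 1 / 2⌉, ∃ q ∈ Lam β 1, p = (0, j) + q := by
  obtain ⟨m, n⟩ := p
  obtain ⟨h1, h2⟩ := hp
  have h3 := abs_le.1 (abs_sub_round (β * m))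
  have h4 := Int.le_ceil (b / 2 + 1 / 2)
  dsimp only at h1 h2
  refine ⟨n - round (β * m), ⟨?_, ?_⟩, (m, round (β * m)), ⟨?_, ?_⟩, by simp⟩
  · have : (-⌈b / 2 + 1 / 2⌉ : ℝ) ≤ ((n - round (β * m) : ℤ) : ℝ) := by
      push_cast
      linarith
    exact_mod_cast this
  · have : ((n - round (β * m) : ℤ) : ℝ) ≤ (⌈b / 2 + 1 / 2⌉ : ℝ) := by
      push_cast
      linarith
    exact_mod_cast this
  · dsimp only
    linarith
  · dsimp only
    linarith

theorem totallyBounded_image_Lam {T : ℤ × ℤ → X → X} (hT : ∀ g, Measurable (T g))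
    (hadd : ∀ v w, T (v + w) = T v ∘ T w) {β : ℝ}
    (h : ∀ B, MeasurableSet B → TotallyBounded ((fun g => indL2 μ (T g ⁻¹' B)) '' Lam β 1))
    (b : ℝ) {B : Set X} (hB : MeasurableSet B) :
    TotallyBounded ((fun g => indL2 μ (T g ⁻¹' B)) '' Lam β b) := by
  refine TotallyBounded.subset ?_ ((totallyBounded_biUnion
    (Set.finite_Icc (-⌈b / 2 + 1 / 2⌉) ⌈b / 2 + 1 / 2⌉)).2
    fun j _ => h (T (0, j) ⁻¹' B) (hT _ hB))
  rintro _ ⟨p, hp, rfl⟩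
  obtain ⟨j, hj, q, hq, rfl⟩ := exists_vertical_translate hp
  refine Set.mem_biUnion hj ⟨q, hq, ?_⟩
  simp only [hadd, Set.preimage_comp]

end Strip

/-- `μ` has `v`-discrete spectrum iff the system is `v`-null. -/
theorem dirDiscreteSpectrum_iff_dirNull
    {X : Type*} [MetricSpace X] [CompactSpace X] [MeasurableSpace X] [BorelSpace X]
    (μ : Measure X) [IsProbabilityMeasure μ] (T : ℤ × ℤ → X → X)
    (hT : IsZ2MPS μ T) (β : ℝ) :
    dirKron μ T β 1 = {B : Set X | MeasurableSet B} ↔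
      ∀ b : ℝ, 0 < b → ∀ w : ℕ → ℤ × ℤ, EnumIn w (Lam β b) →
        seqEntSup μ T w = 0 := by
  obtain ⟨-, -, hadd, hmp⟩ := hT
  have hm : ∀ g, Measurable (T g) := fun g => (hmp g).measurable
  have hiff : ∀ B, MeasurableSet B → (B ∈ dirKron μ T β 1 ↔
      TotallyBounded ((fun g => indL2 μ (T g ⁻¹' B)) '' Lam β 1)) := fun B hB => by
    rw [← korbit_isCompact_closure_iff μ hm hB]
    exact and_iff_right hB
  constructor
  · intro h b _ w hw
    have hB : ∀ B, MeasurableSet B →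
        TotallyBounded ((fun g => indL2 μ (T g ⁻¹' B)) '' Lam β 1) := fun B hB =>
      (hiff B hB).1 (h.symm ▸ hB)
    exact seqEntSup_eq_zero μ hm (fun A hA => totallyBounded_image_Lam μ hm hadd hB b hA) hw.2
  · intro h
    refine Set.Subset.antisymm (fun B hB => hB.1) fun B hB => (hiff B hB).2 ?_
    by_contra hnot
    obtain ⟨w, hw, hne⟩ := exists_seqEntSup_ne_zero μ hmp hB hnot
    exact hne (h 1 one_pos w hw)

end Directional
end

section
/- Let $(X,\mathcal{B}_X,\mu,T)$ be a $\mathbb{Z}^2$-MPS. The following are equivalent: (a) there exist two direction vectors $\vec v=(1,\beta_1)$ and $\vec w=(1,\beta_2)$ with $\beta_1\ne\beta_2$ such that $\mu$ has $\vec v$-discrete spectrum and $\vec w$-discrete spectrum; (b) $\mu$ has discrete spectrum. -/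
open MeasureTheory Filter Set
open scoped ENNReal Topology

namespace Directional

noncomputable section

attribute [local instance] Classical.propDecidable

variable {X : Type*} [MeasurableSpace X] {G : Type*}

end
open scoped Pointwise

lemma korbit_eq_image_s5 {X G : Type*} [MeasurableSpace X] {μ : Measure X} [IsFiniteMeasure μ]
    {T : G → X → X} (h : ∀ w, MeasurePreserving (T w) μ μ) (Λ : Set G) {B : Set X}
    (hB : MeasurableSet B) :
    korbit μ T Λ B =
      (fun w => Lp.compMeasurePreserving (T w) (h w)
        (indicatorConstLp 2 hB (measure_ne_top μ B) (1 : ℝ))) '' Λ := by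
  have key (w : G) : (Lp.compMeasurePreserving (T w) (h w)
      (indicatorConstLp 2 hB (measure_ne_top μ B) (1 : ℝ)) : X → ℝ) =ᵐ[μ]
        fun x => B.indicator (fun _ => (1 : ℝ)) (T w x) :=
    (Lp.coeFn_compMeasurePreserving _ (h w)).trans
      ((h w).quasiMeasurePreserving.ae_eq_comp indicatorConstLp_coeFn)
  ext g
  constructor
  · rintro ⟨w, hw, hg⟩
    exact ⟨w, hw, Lp.ext ((key w).trans hg.symm)⟩
  · rintro ⟨w, hw, rfl⟩
    exact ⟨w, hw, key w⟩

lemma korbit_mono {X G : Type*} [MeasurableSpace X] (μ : Measure X) (T : G → X → X)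
    {Λ Λ' : Set G} (h : Λ ⊆ Λ') (B : Set X) : korbit μ T Λ B ⊆ korbit μ T Λ' B :=
  fun _ ⟨w, hw, hg⟩ => ⟨w, h hw, hg⟩

lemma isCompact_closure_iff_totallyBounded {E : Type*} [UniformSpace E] [CompleteSpace E]
    {s : Set E} : IsCompact (closure s) ↔ TotallyBounded s :=
  ⟨fun h => h.totallyBounded.subset subset_closure,
    fun h => h.closure.isCompact_of_isClosed isClosed_closure⟩

/-- If every measurable set has a precompact orbit along `Λ₁` and `B` has a precompact orbit
along `Λ₂`, then `B` has a precompact orbit along `Λ₁ + Λ₂`. -/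
lemma totallyBounded_korbit_add {X G : Type*} [MeasurableSpace X] [AddCommGroup G]
    {μ : Measure X} [IsFiniteMeasure μ] {T : G → X → X}
    (h : ∀ w, MeasurePreserving (T w) μ μ) (hadd : ∀ v w, T (v + w) = T v ∘ T w)
    {Λ₁ Λ₂ : Set G} {B : Set X} (hB : MeasurableSet B)
    (h₁ : ∀ A, MeasurableSet A → TotallyBounded (korbit μ T Λ₁ A))
    (h₂ : TotallyBounded (korbit μ T Λ₂ B)) :
    TotallyBounded (korbit μ T (Λ₁ + Λ₂) B) := by
  rw [Metric.totallyBounded_iff]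
  intro ε hε
  rw [korbit_eq_image_s5 h Λ₂ hB] at h₂
  obtain ⟨t, hts, htf, ht⟩ := Metric.finite_approx_of_totallyBounded h₂ (ε / 2) (half_pos hε)
  have h₃ : TotallyBounded (⋃ f ∈ t,
      (fun p => Lp.compMeasurePreserving (T p) (h p) f) '' Λ₁) := by
    rw [totallyBounded_biUnion htf]
    intro f hf
    obtain ⟨q, -, rfl⟩ := hts hf
    have := h₁ _ (hB.preimage (h q).measurable)
    rwa [korbit_eq_image_s5 h Λ₁ (hB.preimage (h q).measurable)] at this
  obtain ⟨s, hsf, hs⟩ := Metric.totallyBounded_iff.1 h₃ (ε / 2) (half_pos hε)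
  refine ⟨s, hsf, ?_⟩
  rw [korbit_eq_image_s5 h _ hB]
  rintro _ ⟨_, ⟨p, hp, q, hq, rfl⟩, rfl⟩
  obtain ⟨f, hf, hqf⟩ := mem_iUnion₂.1 (ht ⟨q, hq, rfl⟩)
  obtain ⟨g, hg, hfg⟩ := mem_iUnion₂.1 (hs (mem_iUnion₂.2 ⟨f, hf, p, hp, rfl⟩))
  refine mem_iUnion₂.2 ⟨g, hg, ?_⟩
  have hpq : Lp.compMeasurePreserving (T (p + q)) (h (p + q))
      (indicatorConstLp 2 hB (measure_ne_top μ B) (1 : ℝ)) =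
      Lp.compMeasurePreserving (T p) (h p) (Lp.compMeasurePreserving (T q) (h q)
        (indicatorConstLp 2 hB (measure_ne_top μ B) (1 : ℝ))) := by
    have hT : T (p + q) = T q ∘ T p := by rw [add_comm, hadd]
    simp only [Lp.indicatorConstLp_compMeasurePreserving, hT, preimage_comp]
  simp only [hpq, Metric.mem_ball] at hqf hfg ⊢
  calc _ ≤ _ + _ := dist_triangle _ (Lp.compMeasurePreserving (T p) (h p) f) _
    _ < ε / 2 + ε / 2 := add_lt_add
      (by rwa [(Lp.isometry_compMeasurePreserving (h p)).dist_eq]) hfg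
    _ = ε := add_halves ε

lemma round_mem_Lam (β : ℝ) (m : ℤ) : (m, round (β * m)) ∈ Lam β 1 := by
  have := abs_le.1 (abs_sub_round (β * m))
  constructor <;> dsimp only <;> linarith [this.1, this.2]

/-- Two strips in different directions together generate the lattice up to a finite set. -/
lemma exists_finite_Lam_add_Lam_add_eq_univ {β₁ β₂ : ℝ} (hβ : β₁ ≠ β₂) :
    ∃ F : Set (ℤ × ℤ), F.Finite ∧ Lam β₁ 1 + Lam β₂ 1 + F = univ := by
  obtain ⟨N, hN⟩ := exists_nat_ge (|β₁ - β₂| + 1)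
  refine ⟨(fun j : ℤ => ((0 : ℤ), j)) '' Icc (-N) N, (finite_Icc _ _).image _, ?_⟩
  refine eq_univ_of_forall fun ⟨m, n⟩ => ?_
  have hd : β₁ - β₂ ≠ 0 := sub_ne_zero.2 hβ
  set s : ℝ := (n - β₂ * m) / (β₁ - β₂)
  have hs' : (β₁ - β₂) * s = n - β₂ * m := mul_div_cancel₀ _ hd
  set k : ℤ := ⌊s⌋
  set a : ℤ := round (β₁ * k)
  set b : ℤ := round (β₂ * (m - k : ℤ))
  have ha : |β₁ * k - a| ≤ 1 / 2 := abs_sub_round _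
  have hb : |β₂ * (m - k : ℤ) - b| ≤ 1 / 2 := abs_sub_round _
  have hk : |(β₁ - β₂) * (s - k)| ≤ |β₁ - β₂| := by
    rw [abs_mul]
    refine mul_le_of_le_one_right (abs_nonneg _) ?_
    exact (abs_of_nonneg (Int.fract_nonneg s)).trans_le (Int.fract_lt_one s).le
  have hj : |((n - a - b : ℤ) : ℝ)| ≤ N := by
    rw [abs_le] at ha hb hk ⊢
    push_cast at ha hb ⊢
    constructor <;> linarith
  have hj' : |n - a - b| ≤ (N : ℤ) := by exact_mod_cast hj
  refine ⟨(k, a) + (m - k, b), add_mem_add (round_mem_Lam β₁ k) (round_mem_Lam β₂ (m - k)),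
    (0, n - a - b), ⟨_, abs_le.1 hj', rfl⟩, ?_⟩
  ext <;> simp

/-- `μ` has discrete spectrum iff it has directional discrete
spectrum in two distinct directions `(1,β₁)`, `(1,β₂)`. -/
theorem discreteSpectrum_iff_two_directions
    {X : Type*} [MetricSpace X] [CompactSpace X] [MeasurableSpace X] [BorelSpace X]
    (μ : Measure X) [IsProbabilityMeasure μ] (T : ℤ × ℤ → X → X)
    (hT : IsZ2MPS μ T) :
    (∃ β₁ β₂ : ℝ, β₁ ≠ β₂ ∧
        dirKron μ T β₁ 1 = {B : Set X | MeasurableSet B} ∧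
        dirKron μ T β₂ 1 = {B : Set X | MeasurableSet B}) ↔
      kron μ T = {B : Set X | MeasurableSet B} := by
  obtain ⟨-, -, hadd, h⟩ := hT
  constructor
  · rintro ⟨β₁, β₂, hβ, h₁, h₂⟩
    have tb {β : ℝ} (hβ : dirKron μ T β 1 = {B : Set X | MeasurableSet B}) (A : Set X)
        (hA : MeasurableSet A) : TotallyBounded (korbit μ T (Lam β 1) A) :=
      isCompact_closure_iff_totallyBounded.1 (hβ.ge hA).2
    obtain ⟨F, hF, hFu⟩ := exists_finite_Lam_add_Lam_add_eq_univ hβ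
    refine Subset.antisymm (fun B hB => hB.1) fun B hB =>
      ⟨hB, isCompact_closure_iff_totallyBounded.2 ?_⟩
    rw [← hFu]
    refine totallyBounded_korbit_add h hadd hB
      (fun A hA => totallyBounded_korbit_add h hadd hA (tb h₁) (tb h₂ A hA)) ?_
    rw [korbit_eq_image_s5 h F hB]
    exact (hF.image _).totallyBounded
  · intro hk
    have hdir (β : ℝ) : dirKron μ T β 1 = {B : Set X | MeasurableSet B} :=
      Subset.antisymm (fun B hB => hB.1) fun B hB =>
        ⟨hB, (hk.ge hB).2.of_isClosed_subset isClosed_closure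
          (closure_mono (korbit_mono μ T (subset_univ _) B))⟩
    exact ⟨0, 1, zero_ne_one, hdir 0, hdir 1⟩

end Directional
end

section
/- Let $\vec v=(1,\beta_1)$ and $\vec w=(1,\beta_2)$ be direction vectors in $\mathbb{R}^2$ with $\beta_1\ne\beta_2$. Then for every real $b>4([|\beta_1-\beta_2|]+1)$ (where $[t]$ is the integer part of $t$), one has $\mathbb{Z}^2=\Lambda^{\vec v}(b)+\Lambda^{\vec w}(b)$, i.e. every $(m,n)\in\mathbb{Z}^2$ can be written as $(m_1+m_2,n_1+n_2)$ with $(m_1,n_1)\in\Lambda^{\vec v}(b)$ and $(m_2,n_2)\in\Lambda^{\vec w}(b)$. -/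
open MeasureTheory Filter Set
open scoped ENNReal Topology

namespace Directional

noncomputable section

attribute [local instance] Classical.propDecidable

variable {X : Type*} [MeasurableSpace X] {G : Type*}

/-- The two-element partition `{B, Bᶜ}`. -/
def pairPart (B : Set X) : Finset (Set X) := {B, Bᶜ}

/-- The pulled-back partition `T^{-g} α = {T_g⁻¹ A : A ∈ α}`. -/
def pullPart (T : G → X → X) (g : G) (α : Finset (Set X)) : Finset (Set X) :=
  α.image fun A => T g ⁻¹' A

end
/-- if `β₁ ≠ β₂` and `b > 4([|β₁-β₂|]+1)` then
`ℤ² = Λ^{(1,β₁)}(b) + Λ^{(1,β₂)}(b)`. -/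
theorem strip_add_strip_eq_univ (β₁ β₂ : ℝ) (hβ : β₁ ≠ β₂) (b : ℝ)
    (hb : 4 * ((⌊|β₁ - β₂|⌋ : ℝ) + 1) < b) :
    ∀ p : ℤ × ℤ, ∃ p₁ ∈ Lam β₁ b, ∃ p₂ ∈ Lam β₂ b, p = p₁ + p₂ := by
  rintro ⟨m, n⟩
  have hd : β₁ - β₂ ≠ 0 := sub_ne_zero.mpr hβ
  have hfl := Int.lt_floor_add_one |β₁ - β₂|
  have hfl₀ : (0 : ℝ) ≤ ⌊|β₁ - β₂|⌋ := by
    exact_mod_cast Int.floor_nonneg.mpr (abs_nonneg (β₁ - β₂))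
  -- the lines of slopes `β₁` through `0` and `β₂` through `(m, n)` meet at abscissa `x`
  set x : ℝ := (n - β₂ * m) / (β₁ - β₂)
  have hxd : (β₁ - β₂) * x = n - β₂ * m := mul_div_cancel₀ _ hd
  set k : ℤ := round x
  set l : ℤ := round (β₁ * k)
  have hl := abs_le.mp (abs_sub_round (β₁ * (k : ℝ)))
  have hk : |(β₁ - β₂) * (x - k)| ≤ |β₁ - β₂| * (1 / 2) := by
    rw [abs_mul]
    exact mul_le_mul_of_nonneg_left (abs_sub_round x) (abs_nonneg _)
  have hk' := abs_le.mp hk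
  have hexp : (β₁ - β₂) * (x - k) = n - β₂ * m - (β₁ - β₂) * k := by
    rw [mul_sub, hxd]
  rw [hexp] at hk'
  refine ⟨(k, l), ⟨?_, ?_⟩, (m - k, n - l), ⟨?_, ?_⟩, by simp⟩ <;>
    push_cast <;> linarith [hl.1, hl.2, hk'.1, hk'.2, abs_nonneg (β₁ - β₂)]

end Directional
end
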